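/- Let n ≥ 1 and M ≥ 1 be integers, let u, v : {1,…,n} → ℤ be injective functions with 1 ≤ u(i) ≤ M and 1 ≤ v(i) ≤ M for all i, and set B := M + 1. In the Euclidean plane define the sequence of 2n+2 points p_1, …, p_{2n+2} by p_i = (0, u(i)) for 1 ≤ i ≤ n, p_{n+1} = (0, B), p_{n+2} = (B, B), and p_{n+2+i} = (B, v(i)) for 1 ≤ i ≤ n. Then there exist indices i, j with u(i) = v(j) if and only if there exists a pyramidal tour of p_1, …, p_{2n+2} whose bottleneck is at most B. -/

import Mathlib

noncomputable section

/-- Points in the Euclidean plane. -/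
abbrev Pt := EuclideanSpace ℝ (Fin 2)

/-- The pairs `(x, x')` of elements of `X` with `x < x'` that are consecutive in `X`,
i.e. no element of `X` lies strictly between them. -/
def consecPairs (X : Finset ℕ) : Finset (ℕ × ℕ) :=
  (X ×ˢ X).filter fun q => q.1 < q.2 ∧ ∀ y ∈ X, ¬ (q.1 < y ∧ y < q.2)

/-- The chain bottleneck of `X`: the maximum distance between consecutive elements of `X`
(`0` if `X` has at most one element). -/
def chainBot (p : ℕ → Pt) (X : Finset ℕ) : ℝ :=
  (consecPairs X).fold max 0 fun q => dist (p q.1) (p q.2)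

/-- `(S, T)` is a pyramidal tour of `p₁,…,pₘ`: `S ∪ T = {1,…,m}` and `S ∩ T = {1, m}`. -/
def IsPyramidal (m : ℕ) (S T : Finset ℕ) : Prop :=
  S ∪ T = Finset.Icc 1 m ∧ S ∩ T = {1, m}

theorem chainBot_le_iff (p : ℕ → Pt) (X : Finset ℕ) (B : ℝ) (hB : 0 ≤ B) :
    chainBot p X ≤ B ↔ ∀ x ∈ X, ∀ y ∈ X, x < y → (∀ z ∈ X, ¬ (x < z ∧ z < y)) →
      dist (p x) (p y) ≤ B := by
  unfold chainBot
  rw [Finset.fold_max_le]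
  constructor
  · rintro ⟨-, h⟩ x hx y hy hxy hz
    exact h (x, y) (by
      unfold consecPairs
      simp only [Finset.mem_filter, Finset.mem_product]
      exact ⟨⟨hx, hy⟩, hxy, hz⟩)
  · intro h
    refine ⟨hB, ?_⟩
    rintro ⟨x, y⟩ hq
    unfold consecPairs at hq
    simp only [Finset.mem_filter, Finset.mem_product] at hq
    exact h x hq.1.1 y hq.1.2 hq.2.1 hq.2.2

theorem pt_dist_le_iff (a b : Pt) (B : ℝ) (hB : 0 ≤ B) :
    dist a b ≤ B ↔ (a 0 - b 0) ^ 2 + (a 1 - b 1) ^ 2 ≤ B ^ 2 := by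
  rw [EuclideanSpace.dist_eq, Real.sqrt_le_left hB, Fin.sum_univ_two]
  simp only [Real.dist_eq, sq_abs]

theorem exists_crossing (X : Finset ℕ) (k a b : ℕ) (ha : a ∈ X) (hak : a ≤ k)
    (hb : b ∈ X) (hkb : k < b) :
    ∃ x ∈ X, ∃ y ∈ X, x ≤ k ∧ k < y ∧ ∀ z ∈ X, ¬ (x < z ∧ z < y) := by
  obtain ⟨x, hx, hxm⟩ := (X.filter (· ≤ k)).exists_max_image id ⟨a, by simp [ha, hak]⟩
  obtain ⟨y, hy, hym⟩ := (X.filter (k < ·)).exists_min_image id ⟨b, by simp [hb, hkb]⟩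
  simp only [Finset.mem_filter, id] at hx hy hxm hym
  refine ⟨x, hx.1, y, hy.1, hx.2, hy.2, ?_⟩
  rintro z hz ⟨h1, h2⟩
  by_cases h : z ≤ k
  · have := hxm z ⟨hz, h⟩
    omega
  · have := hym z ⟨hz, by omega⟩
    omega

/-- Correctness of the reduction from Set Disjointness to the decision version of
bottleneck pyramidal TSP. -/
theorem stmt_14 (n M : ℕ) (hn : 1 ≤ n) (hM : 1 ≤ M)
    (u v : ℕ → ℤ)
    (hu : Set.InjOn u (Set.Icc 1 n)) (hv : Set.InjOn v (Set.Icc 1 n))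
    (hub : ∀ i, 1 ≤ i → i ≤ n → 1 ≤ u i ∧ u i ≤ M)
    (hvb : ∀ i, 1 ≤ i → i ≤ n → 1 ≤ v i ∧ v i ≤ M)
    (B : ℝ) (hB : B = M + 1)
    (p : ℕ → Pt)
    (hp₁ : ∀ i, 1 ≤ i → i ≤ n → p i 0 = 0 ∧ p i 1 = (u i : ℝ))
    (hp₂ : p (n + 1) 0 = 0 ∧ p (n + 1) 1 = B)
    (hp₃ : p (n + 2) 0 = B ∧ p (n + 2) 1 = B)
    (hp₄ : ∀ i, 1 ≤ i → i ≤ n → p (n + 2 + i) 0 = B ∧ p (n + 2 + i) 1 = (v i : ℝ)) :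
    (∃ i j, 1 ≤ i ∧ i ≤ n ∧ 1 ≤ j ∧ j ≤ n ∧ u i = v j) ↔
      ∃ S T : Finset ℕ, IsPyramidal (2 * n + 2) S T ∧
        max (chainBot p S) (chainBot p T) ≤ B := by
  have hMr : (1 : ℝ) ≤ M := by exact_mod_cast hM
  have hB0 : 0 ≤ B := by linarith
  have hL : ∀ x, 1 ≤ x → x ≤ n + 1 → p x 0 = 0 ∧ 0 ≤ p x 1 ∧ p x 1 ≤ B := by
    intro x h1 h2
    rcases Nat.lt_or_ge n x with h | h
    · obtain rfl : x = n + 1 := by omega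
      exact ⟨hp₂.1, by rw [hp₂.2]; exact hB0, hp₂.2.le⟩
    · obtain ⟨e0, e1⟩ := hp₁ x h1 h
      obtain ⟨b1, b2⟩ := hub x h1 h
      have b1' : (1 : ℝ) ≤ u x := by exact_mod_cast b1
      have b2' : (u x : ℝ) ≤ M := by exact_mod_cast b2
      exact ⟨e0, by rw [e1]; linarith, by rw [e1]; linarith⟩
  have hR : ∀ x, n + 2 ≤ x → x ≤ 2 * n + 2 → p x 0 = B ∧ 0 ≤ p x 1 ∧ p x 1 ≤ B := by
    intro x h1 h2
    obtain ⟨j, rfl⟩ := Nat.exists_eq_add_of_le h1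
    rcases Nat.eq_zero_or_pos j with h | h
    · subst h
      exact ⟨hp₃.1, by rw [add_zero, hp₃.2]; exact hB0, hp₃.2.le⟩
    · obtain ⟨e0, e1⟩ := hp₄ j h (by omega)
      obtain ⟨b1, b2⟩ := hvb j h (by omega)
      have b1' : (1 : ℝ) ≤ v j := by exact_mod_cast b1
      have b2' : (v j : ℝ) ≤ M := by exact_mod_cast b2
      exact ⟨e0, by rw [e1]; linarith, by rw [e1]; linarith⟩
  constructor
  · rintro ⟨i, j, hi1, hin, hj1, hjn, hij⟩
    have key : ∀ X : Finset ℕ, X ⊆ Finset.Icc 1 (2 * n + 2) →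
        (∀ x ∈ X, ∀ y ∈ X, x ≤ n + 1 → n + 2 ≤ y → (∀ z ∈ X, ¬ (x < z ∧ z < y)) →
          p x 1 = p y 1) → chainBot p X ≤ B := by
      intro X hX hc
      rw [chainBot_le_iff _ _ _ hB0]
      intro x hx y hy hxy hz
      rw [pt_dist_le_iff _ _ _ hB0]
      have hx' := Finset.mem_Icc.1 (hX hx)
      have hy' := Finset.mem_Icc.1 (hX hy)
      rcases Nat.lt_or_ge (n + 1) x with h1 | h1
      · obtain ⟨a1, a2, a3⟩ := hR x (by omega) hx'.2
        obtain ⟨b1, b2, b3⟩ := hR y (by omega) hy'.2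
        rw [a1, b1]; nlinarith
      · obtain ⟨a1, a2, a3⟩ := hL x hx'.1 h1
        rcases Nat.lt_or_ge (n + 1) y with h2 | h2
        · obtain ⟨b1, b2, b3⟩ := hR y (by omega) hy'.2
          rw [a1, b1, hc x hx y hy h1 h2 hz]; nlinarith
        · obtain ⟨b1, b2, b3⟩ := hL y hy'.1 h2
          rw [a1, b1]; nlinarith
    refine ⟨Finset.Icc 1 i ∪ Finset.Icc (n + 2 + j) (2 * n + 2),
      {1, 2 * n + 2} ∪ Finset.Icc (i + 1) (n + 1 + j), ⟨?_, ?_⟩, max_le (key _ ?_ ?_) (key _ ?_ ?_)⟩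
    · ext x
      simp only [Finset.mem_union, Finset.mem_Icc, Finset.mem_insert, Finset.mem_singleton]
      omega
    · ext x
      simp only [Finset.mem_union, Finset.mem_inter, Finset.mem_Icc, Finset.mem_insert,
        Finset.mem_singleton]
      omega
    · intro x
      simp only [Finset.mem_union, Finset.mem_Icc]
      omega
    · intro x hx y hy h1 h2 hz
      have z1 := hz i
      have z2 := hz (n + 2 + j)
      simp only [Finset.mem_union, Finset.mem_Icc] at hx hy z1 z2
      obtain rfl : x = i := by omega
      obtain rfl : y = n + 2 + j := by omega
      rw [(hp₁ _ hi1 hin).2, (hp₄ _ hj1 hjn).2, hij]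
    · intro x
      simp only [Finset.mem_union, Finset.mem_Icc, Finset.mem_insert, Finset.mem_singleton]
      omega
    · intro x hx y hy h1 h2 hz
      have z1 := hz (n + 1)
      have z2 := hz (n + 2)
      simp only [Finset.mem_union, Finset.mem_Icc, Finset.mem_insert,
        Finset.mem_singleton] at hx hy z1 z2
      obtain rfl : x = n + 1 := by omega
      obtain rfl : y = n + 2 := by omega
      rw [hp₂.2, hp₃.2]
  · rintro ⟨S, T, ⟨hU, hI⟩, hmax⟩
    by_contra hno
    have key : ∀ X : Finset ℕ, X ⊆ Finset.Icc 1 (2 * n + 2) → 1 ∈ X → 2 * n + 2 ∈ X →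
        chainBot p X ≤ B → n + 1 ∈ X := by
      intro X hX h1 hm hb
      rw [chainBot_le_iff _ _ _ hB0] at hb
      obtain ⟨x, hx, y, hy, hxk, hky, hz⟩ :=
        exists_crossing X (n + 1) 1 (2 * n + 2) h1 (by omega) hm (by omega)
      have hd := hb x hx y hy (by omega) hz
      rw [pt_dist_le_iff _ _ _ hB0] at hd
      have hx' := Finset.mem_Icc.1 (hX hx)
      have hy' := Finset.mem_Icc.1 (hX hy)
      rw [(hL x hx'.1 hxk).1, (hR y hky hy'.2).1] at hd
      have he : p x 1 = p y 1 := by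
        have : (p x 1 - p y 1) ^ 2 = 0 := le_antisymm (by nlinarith) (sq_nonneg _)
        have := pow_eq_zero_iff (two_ne_zero) |>.1 this
        linarith
      by_contra hn1
      have hxn : x ≤ n := by
        rcases Nat.lt_or_ge n x with h | h
        · obtain rfl : x = n + 1 := by omega
          exact absurd hx hn1
        · exact h
      have b2 : (u x : ℝ) ≤ M := by exact_mod_cast (hub x hx'.1 hxn).2
      rw [(hp₁ x hx'.1 hxn).2] at he
      obtain ⟨j, rfl⟩ := Nat.exists_eq_add_of_le (show n + 2 ≤ y from hky)
      rcases Nat.eq_zero_or_pos j with h | h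
      · subst h
        rw [add_zero, hp₃.2] at he
        linarith
      · rw [(hp₄ j h (by omega)).2] at he
        exact hno ⟨x, j, hx'.1, hxn, h, by omega, Int.cast_injective (α := ℝ) he⟩
    have hmem : ∀ x, x ∈ S ∩ T ↔ x = 1 ∨ x = 2 * n + 2 := by
      intro x; rw [hI]; simp
    have m1 := Finset.mem_inter.1 ((hmem 1).2 (Or.inl rfl))
    have m2 := Finset.mem_inter.1 ((hmem (2 * n + 2)).2 (Or.inr rfl))
    have s1 := key S (hU ▸ Finset.subset_union_left) m1.1 m2.1 ((le_max_left _ _).trans hmax)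
    have s2 := key T (hU ▸ Finset.subset_union_right) m1.2 m2.2 ((le_max_right _ _).trans hmax)
    have := (hmem (n + 1)).1 (Finset.mem_inter.2 ⟨s1, s2⟩)
    omega
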